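/- Let A be a finite dimensional selfinjective k-algebra in which all projective indecomposable modules have the same dimension d, and let X be a module of length 3 with simple socle and head of length 2. If Ω²(X) ≅ X, then a contradiction arises; hence X is not Ω-periodic of period dividing 2. (Precisely: from an exact sequence 0 → X → P → Q → X → 0 with P the injective hull of X and Q projective of the same dimension as P, Q must be indecomposable, forcing the head of X to be simple, contradicting that the head has length 2.) -/

import Mathlib

set_option maxHeartbeats 1000000
set_option synthInstance.maxHeartbeats 400000

/-- The radical `rad(M) = J(A)·M` of a module. -/
noncomputable abbrev moduleRadical (A : Type*) [Ring A] (M : Type*) [AddCommGroup M]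
    [Module A M] : Submodule A M :=
  (Ideal.jacobson (⊥ : Ideal A)) • (⊤ : Submodule A M)

/-- The socle of a module: the sum of all its simple submodules. -/
noncomputable abbrev moduleSocle (A : Type*) [Ring A] (M : Type*) [AddCommGroup M]
    [Module A M] : Submodule A M :=
  sSup {S : Submodule A M | IsSimpleModule A S}

/-- A module has composition length `m` if it has a composition series of length `m`
from `⊥` to `⊤`. -/
def moduleLengthIs (A : Type*) [Ring A] (M : Type*) [AddCommGroup M] [Module A M]
    (m : ℕ) : Prop :=
  ∃ s : CompositionSeries (Submodule A M), s.head = ⊥ ∧ s.last = ⊤ ∧ s.length = m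

/-- A module is indecomposable if it is nonzero and admits no nontrivial direct sum
decomposition. -/
def IsIndecomposableModule (A : Type*) [Ring A] (M : Type*) [AddCommGroup M]
    [Module A M] : Prop :=
  Nontrivial M ∧ ∀ N P : Submodule A M, IsCompl N P → N = ⊥ ∨ P = ⊥

theorem aux_fg_proj_injective (A : Type) [Ring A] (hself : Module.Injective A A)
    (N : Type) [AddCommGroup N] [Module A N] [Module.Finite A N] [Module.Projective A N] :
    Module.Injective A N := by
  obtain ⟨n, p, hp⟩ := Module.Finite.exists_fin' A N
  obtain ⟨s, hs⟩ := Module.projective_lifting_property p LinearMap.id hp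
  have : Module.Injective A (Fin n → A) := inferInstance
  refine ⟨fun X Y _ _ _ _ f hf g => ?_⟩
  obtain ⟨h, hh⟩ := Module.Injective.out f hf (s ∘ₗ g)
  refine ⟨p ∘ₗ h, fun x => ?_⟩
  simp only [LinearMap.comp_apply, hh]
  exact LinearMap.congr_fun hs (g x)

theorem aux_indec_sup (A : Type) [Ring A]
    (Q : Type) [AddCommGroup Q] [Module A Q] [Module.Projective A Q]
    [IsArtinian A Q] [IsNoetherian A Q] (hQ : IsIndecomposableModule A Q)
    (M N : Submodule A Q) (h : M ⊔ N = ⊤) : M = ⊤ ∨ N = ⊤ := by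
  have hsurj : Function.Surjective (M.subtype.coprod N.subtype) := by
    rw [← LinearMap.range_eq_top, LinearMap.range_coprod]
    simpa using h
  obtain ⟨s, hs⟩ := Module.projective_lifting_property _ LinearMap.id hsurj
  set a : Module.End A Q := M.subtype ∘ₗ LinearMap.fst A M N ∘ₗ s with ha
  set b : Module.End A Q := N.subtype ∘ₗ LinearMap.snd A M N ∘ₗ s with hb
  have hab : a + b = 1 := by
    rw [← show _ = (1 : Module.End A Q) from hs]
    ext x
    simp [ha, hb, LinearMap.coprod_apply]
  have haM : LinearMap.range a ≤ M := by
    rintro _ ⟨x, rfl⟩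
    simp [ha]
  have hbN : LinearMap.range b ≤ N := by
    rintro _ ⟨x, rfl⟩
    simp [hb]
  obtain ⟨n, hn⟩ := Filter.eventually_atTop.mp a.eventually_isCompl_ker_pow_range_pow
  have hc := hn (n + 1) (by omega)
  rcases hQ.2 _ _ hc with h0 | h0
  · left
    have hinj : Function.Injective a := by
      have h1 : Function.Injective (a ^ (n + 1)) := LinearMap.ker_eq_bot.mp h0
      rw [pow_succ] at h1
      exact Function.Injective.of_comp (f := (a ^ n : Module.End A Q)) h1
    have := IsArtinian.surjective_of_injective_endomorphism a hinj
    rw [← top_le_iff, ← LinearMap.range_eq_top.mpr this]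
    exact haM
  · right
    have hnil : IsNilpotent a := ⟨n + 1, LinearMap.range_eq_bot.mp h0⟩
    have hu : IsUnit b := by
      have : b = 1 - a := by rw [← hab]; abel
      rw [this]
      exact hnil.isUnit_one_sub
    have := ((Module.End.isUnit_iff b).mp hu).surjective
    rw [← top_le_iff, ← LinearMap.range_eq_top.mpr this]
    exact hbN

theorem aux_finrank_compl (k : Type) [Field k] (A : Type) [Ring A] [Algebra k A]
    (N : Type) [AddCommGroup N] [Module A N] [Module k N] [IsScalarTower k A N]
    [FiniteDimensional k N] (U V : Submodule A N) (h : IsCompl U V) :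
    Module.finrank k U + Module.finrank k V = Module.finrank k N := by
  have e := (Submodule.prodEquivOfIsCompl U V h).restrictScalars k
  have : Module.Finite k U := Module.Finite.of_injective (U.subtype.restrictScalars k) U.subtype_injective
  have : Module.Finite k V := Module.Finite.of_injective (V.subtype.restrictScalars k) V.subtype_injective
  rw [← e.finrank_eq, Module.finrank_prod]

theorem aux_proj_compl (A : Type) [Ring A]
    (N : Type) [AddCommGroup N] [Module A N] [Module.Projective A N]
    (U V : Submodule A N) (h : IsCompl U V) : Module.Projective A U :=
  Module.Projective.of_split U.subtype (Submodule.projectionOnto U V h) (by ext; simp)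

theorem aux_finrank_indec (k : Type) [Field k]
    (A : Type) [Ring A] [Algebra k A] (d : ℕ)
    (hsame : ∀ R : ModuleCat.{0} A, Module.Finite A R → Module.Projective A R →
      IsIndecomposableModule A R → Module.finrank k (RestrictScalars k A R) = d)
    (N : Type) [AddCommGroup N] [Module A N] [Module k N] [IsScalarTower k A N]
    [Module.Finite A N] [Module.Projective A N] (hN : IsIndecomposableModule A N) :
    Module.finrank k N = d := by
  rw [← hsame (ModuleCat.of A N) ‹_› ‹_› hN]
  let e : RestrictScalars k A N ≃ₗ[k] N :=
    { RestrictScalars.addEquiv k A N with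
      map_smul' := fun c x => by
        change RestrictScalars.addEquiv k A N (c • x) = c • RestrictScalars.addEquiv k A N x
        rw [RestrictScalars.addEquiv_map_smul, algebraMap_smul] }
  exact e.finrank_eq.symm

theorem aux_finrank_ge (k : Type) [Field k]
    (A : Type) [Ring A] [Algebra k A] [FiniteDimensional k A] (d : ℕ)
    (hsame : ∀ R : ModuleCat.{0} A, Module.Finite A R → Module.Projective A R →
      IsIndecomposableModule A R → Module.finrank k (RestrictScalars k A R) = d) (n : ℕ) :
    ∀ (N : Type) [AddCommGroup N] [Module A N] [Module k N] [IsScalarTower k A N]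
    [Module.Finite A N] [Module.Projective A N] [Nontrivial N], Module.finrank k N = n →
    d ≤ Module.finrank k N := by
  induction n using Nat.strong_induction_on with
  | _ n ih =>
  intro N _ _ _ _ _ _ _ hn
  have : FiniteDimensional k N := Module.Finite.trans A N
  have : IsNoetherianRing A := isNoetherian_of_tower k inferInstance
  by_cases hi : IsIndecomposableModule A N
  · exact (aux_finrank_indec k A d hsame N hi).ge
  · simp only [IsIndecomposableModule, not_and, not_forall, not_or] at hi
    obtain ⟨U, V, hUV, hU, hV⟩ := hi ‹_›
    have := aux_proj_compl A N U V hUV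
    have := (Submodule.nontrivial_iff_ne_bot (p := U)).mpr hU
    have := (Submodule.nontrivial_iff_ne_bot (p := V)).mpr hV
    have hs := aux_finrank_compl k A N U V hUV
    have : FiniteDimensional k V := Module.Finite.trans A V
    have hp : 0 < Module.finrank k V := Module.finrank_pos
    have := ih (Module.finrank k U) (by omega) U rfl
    omega

theorem aux_head (k : Type) [Field k] (A : Type) [Ring A] [Algebra k A] [FiniteDimensional k A]
    (X : Type) [AddCommGroup X] [Module A X]
    (hhead : moduleLengthIs A (X ⧸ moduleRadical A X) 2) :
    ∃ M N : Submodule A X, M ≠ ⊤ ∧ N ≠ ⊤ ∧ M ⊔ N = ⊤ := by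
  have : IsArtinianRing A := isArtinian_of_tower k inferInstance
  have hss : IsSemisimpleModule A (X ⧸ moduleRadical A X) := by
    have hJ : Module.IsTorsionBySet A (X ⧸ moduleRadical A X) (Ring.jacobson A) := by
      rintro x ⟨a, ha⟩
      obtain ⟨y, rfl⟩ := Submodule.Quotient.mk_surjective _ x
      change a • (Submodule.Quotient.mk y : X ⧸ moduleRadical A X) = 0
      rw [← Submodule.Quotient.mk_smul, Submodule.Quotient.mk_eq_zero]
      refine Submodule.smul_mem_smul ?_ Submodule.mem_top
      rw [Ideal.jacobson_bot]; exact ha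
    letI := hJ.module
    exact hJ.isSemisimpleModule_iff.mp inferInstance
  obtain ⟨s, h0, h1, hl⟩ := hhead
  set H := X ⧸ moduleRadical A X
  have hlt : ∀ i j : Fin (s.length + 1), i < j → s i < s j := fun i j h => s.strictMono h
  let i1 : Fin (s.length + 1) := ⟨1, by omega⟩
  have hb : ⊥ < s i1 := by
    rw [← h0]; exact hlt 0 i1 (by simp [Fin.lt_def, i1])
  have ht : s i1 < ⊤ := by
    rw [← h1]; exact hlt i1 (Fin.last _) (by simp [Fin.lt_def, i1]; omega)
  obtain ⟨T, hT⟩ := exists_isCompl (s i1)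
  have hTt : T ≠ ⊤ := by
    rintro rfl
    exact hb.ne' (by simpa using hT.disjoint)
  have hsj := Submodule.mkQ_surjective (moduleRadical A X)
  have key : ∀ W : Submodule A H, W ≠ ⊤ → W.comap (moduleRadical A X).mkQ ≠ ⊤ := by
    intro W hW h
    apply hW
    rw [← Submodule.map_comap_eq_of_surjective hsj W, h, Submodule.map_top,
      LinearMap.range_eq_top.mpr hsj]
  refine ⟨_, _, key _ ht.ne, key _ hTt, ?_⟩
  rw [eq_top_iff]
  rintro x -
  have hx : (moduleRadical A X).mkQ x ∈ s i1 ⊔ T := by rw [hT.sup_eq_top]; trivial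
  obtain ⟨u, hu, v, hv, huv⟩ := Submodule.mem_sup.mp hx
  obtain ⟨y, rfl⟩ := hsj v
  refine Submodule.mem_sup.mpr ⟨x - y, ?_, y, hv, by abel⟩
  change (moduleRadical A X).mkQ (x - y) ∈ s i1
  rw [map_sub, ← huv, add_sub_cancel_right]
  exact hu

theorem aux_uniform (A : Type) [Ring A] (X : Type) [AddCommGroup X] [Module A X]
    [IsArtinian A X] (hsoc : IsSimpleModule A (moduleSocle A X)) (U V : Submodule A X)
    (hUV : U ⊓ V = ⊥) : U = ⊥ ∨ V = ⊥ := by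
  have key : ∀ U : Submodule A X, U ≠ ⊥ → moduleSocle A X ≤ U := by
    intro U hU
    obtain ⟨S, hS, hSU⟩ := (eq_bot_or_exists_atom_le U).resolve_left hU
    have hSs : S ≤ moduleSocle A X := le_sSup (isSimpleModule_iff_isAtom.mpr hS)
    rw [← ((isSimpleModule_iff_isAtom.mp hsoc).le_iff.mp hSs).resolve_left hS.1]
    exact hSU
  by_contra! hne
  exact (isSimpleModule_iff_isAtom.mp hsoc).1
    (le_bot_iff.mp (hUV ▸ le_inf (key U hne.1) (key V hne.2)))

theorem aux_main
    (k : Type) [Field k]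
    (A : Type) [Ring A] [Algebra k A] [FiniteDimensional k A]
    (hself : Module.Injective A A)
    (d : ℕ)
    (hsame : ∀ R : ModuleCat.{0} A, Module.Finite A R → Module.Projective A R →
      IsIndecomposableModule A R → Module.finrank k (RestrictScalars k A R) = d)
    (X : Type)
    [AddCommGroup X] [Module A X] [Module.Finite A X]
    (hsoc : IsSimpleModule A (moduleSocle A X))
    (hhead : moduleLengthIs A (X ⧸ moduleRadical A X) 2) (n : ℕ) :
    ∀ (P Q : Type)
    [AddCommGroup P] [Module A P] [Module k P] [IsScalarTower k A P] [Module.Finite A P]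
    [AddCommGroup Q] [Module A Q] [Module k Q] [IsScalarTower k A Q] [Module.Finite A Q]
    (_ : Module.Projective A P) (_ : Module.Projective A Q)
    (f : X →ₗ[A] P) (g : P →ₗ[A] Q) (h : Q →ₗ[A] X)
    (_ : Function.Injective f) (_ : Function.Surjective h)
    (_ : LinearMap.ker g = LinearMap.range f)
    (_ : LinearMap.ker h = LinearMap.range g)
    (_ : Module.finrank k P = Module.finrank k Q) (_ : Module.finrank k P = n),
    False := by
  induction n using Nat.strong_induction_on with
  | _ n ih =>
  intro P Q _ _ _ _ _ _ _ _ _ _ hP hQ f g h hf hh hfg hgh hdim hn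
  have : FiniteDimensional k P := Module.Finite.trans A P
  have : FiniteDimensional k Q := Module.Finite.trans A Q
  have : IsNoetherianRing A := isNoetherian_of_tower k inferInstance
  have : IsArtinianRing A := isArtinian_of_tower k inferInstance
  obtain ⟨M, N, hM, hN, hMN⟩ := aux_head k A X hhead
  have : Nontrivial X := by
    by_contra hX
    rw [not_nontrivial_iff_subsingleton] at hX
    exact hM (Subsingleton.elim _ _)
  have : Nontrivial P := hf.nontrivial
  have : Nontrivial Q := hh.nontrivial
  by_cases hi : IsIndecomposableModule A P
  · have hPd := aux_finrank_indec k A d hsame P hi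
    have hpos : 0 < Module.finrank k P := Module.finrank_pos
    have hQi : IsIndecomposableModule A Q := by
      refine ⟨‹_›, fun U V hUV => ?_⟩
      by_contra! hne
      have := aux_proj_compl A Q U V hUV
      have := aux_proj_compl A Q V U hUV.symm
      have := (Submodule.nontrivial_iff_ne_bot (p := U)).mpr hne.1
      have := (Submodule.nontrivial_iff_ne_bot (p := V)).mpr hne.2
      have h1 := aux_finrank_ge k A d hsame _ U rfl
      have h2 := aux_finrank_ge k A d hsame _ V rfl
      have h3 := aux_finrank_compl k A Q U V hUV
      omega
    have hk : ∀ W : Submodule A X, W.comap h = ⊤ → W = ⊤ := by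
      intro W hW
      rw [← Submodule.map_comap_eq_of_surjective hh W, hW, Submodule.map_top,
        LinearMap.range_eq_top.mpr hh]
    have hsup : M.comap h ⊔ N.comap h = ⊤ := by
      rw [eq_top_iff]
      rintro x -
      have hx : h x ∈ M ⊔ N := by rw [hMN]; trivial
      obtain ⟨u, hu, v, hv, huv⟩ := Submodule.mem_sup.mp hx
      obtain ⟨y, rfl⟩ := hh v
      refine Submodule.mem_sup.mpr ⟨x - y, ?_, y, hv, by abel⟩
      rw [Submodule.mem_comap, map_sub, ← huv, add_sub_cancel_right]
      exact hu
    rcases aux_indec_sup A Q hQi _ _ hsup with h1 | h1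
    · exact hM (hk _ h1)
    · exact hN (hk _ h1)
  · simp only [IsIndecomposableModule, not_and, not_forall, not_or] at hi
    -- a nonzero summand meeting the image of `f` trivially
    obtain ⟨U, V, hUV, hU, hUf⟩ : ∃ U V : Submodule A P, IsCompl U V ∧ U ≠ ⊥ ∧
        U.comap f = ⊥ := by
      obtain ⟨U, V, hUV, hU, hV⟩ := hi ‹_›
      have : U.comap f ⊓ V.comap f = ⊥ := by
        rw [← Submodule.comap_inf, hUV.inf_eq_bot, Submodule.comap_bot,
          LinearMap.ker_eq_bot.mpr hf]
      rcases aux_uniform A X hsoc _ _ this with h1 | h1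
      · exact ⟨U, V, hUV, hU, h1⟩
      · exact ⟨V, U, hUV.symm, hV, h1⟩
    have hUp := aux_proj_compl A P U V hUV
    have := (Submodule.nontrivial_iff_ne_bot (p := U)).mpr hU
    have := aux_fg_proj_injective A hself U
    set e : U →ₗ[A] Q := g ∘ₗ U.subtype with he
    have hei : Function.Injective e := by
      rw [injective_iff_map_eq_zero]
      intro u hu
      have : (u : P) ∈ LinearMap.ker g := hu
      rw [hfg] at this
      obtain ⟨x, hx⟩ := this
      have hx0 : x ∈ U.comap f := by rw [Submodule.mem_comap, hx]; exact u.2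
      rw [hUf, Submodule.mem_bot] at hx0
      rw [hx0, map_zero] at hx
      exact Subtype.ext hx.symm
    obtain ⟨r, hr⟩ := Module.Injective.out e hei LinearMap.id
    have hr' : ∀ u : U, r (g u) = u := hr
    have hgf : ∀ x, g (f x) = 0 := fun x => by
      have : f x ∈ LinearMap.ker g := by rw [hfg]; exact ⟨x, rfl⟩
      exact this
    have hhg : ∀ p, h (g p) = 0 := fun p => by
      have : g p ∈ LinearMap.ker h := by rw [hgh]; exact ⟨p, rfl⟩
      exact this
    have hcP : IsCompl U (LinearMap.ker (r ∘ₗ g)) := by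
      refine ⟨Submodule.disjoint_def.mpr fun x hx hx' => ?_, codisjoint_iff.mpr ?_⟩
      · have := hr' ⟨x, hx⟩
        rw [show r (g x) = 0 from hx'] at this
        exact (congrArg Subtype.val this).symm
      · rw [eq_top_iff]
        rintro x -
        refine Submodule.mem_sup.mpr ⟨r (g x), (r (g x)).2, x - r (g x), ?_, by abel⟩
        rw [LinearMap.mem_ker, LinearMap.comp_apply, map_sub, map_sub, hr', sub_self]
    have hcQ : IsCompl (LinearMap.range e) (LinearMap.ker r) := by
      refine ⟨Submodule.disjoint_def.mpr fun x hx hx' => ?_, codisjoint_iff.mpr ?_⟩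
      · obtain ⟨u, rfl⟩ := hx
        rw [LinearMap.mem_ker, hr] at hx'
        rw [show u = 0 from hx', map_zero]
      · rw [eq_top_iff]
        rintro x -
        refine Submodule.mem_sup.mpr ⟨e (r x), ⟨_, rfl⟩, x - e (r x), ?_, by abel⟩
        rw [LinearMap.mem_ker, map_sub, hr]
        exact sub_self _
    have hd1 := aux_finrank_compl k A P _ _ hcP
    have hd2 := aux_finrank_compl k A Q _ _ hcQ
    have hd3 : Module.finrank k U = Module.finrank k (LinearMap.range e) :=
      ((LinearEquiv.ofInjective e hei).restrictScalars k).finrank_eq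
    have : FiniteDimensional k U := Module.Finite.trans A U
    have hd4 : 0 < Module.finrank k U := Module.finrank_pos
    refine ih (Module.finrank k (LinearMap.ker (r ∘ₗ g))) (by omega)
      (LinearMap.ker (r ∘ₗ g)) (LinearMap.ker r)
      (aux_proj_compl A P _ _ hcP.symm) (aux_proj_compl A Q _ _ hcQ.symm)
      (f.codRestrict _ fun x => by simp [hgf])
      (g.restrict fun x hx => hx)
      (h ∘ₗ (LinearMap.ker r).subtype) ?_ ?_ ?_ ?_ (by omega) rfl
    · intro x y hxy
      exact hf (congrArg Subtype.val hxy)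
    · intro x
      obtain ⟨q, rfl⟩ := hh x
      refine ⟨⟨q - e (r q), ?_⟩, ?_⟩
      · rw [LinearMap.mem_ker, map_sub, hr]
        exact sub_self _
      · change h (q - e (r q)) = h q
        rw [map_sub, show h (e (r q)) = 0 from hhg _, sub_zero]
    · ext ⟨p, hp⟩
      constructor
      · intro hx
        have : p ∈ LinearMap.ker g := congrArg Subtype.val (show _ = _ from hx)
        rw [hfg] at this
        obtain ⟨x, hx⟩ := this
        exact ⟨x, Subtype.ext hx⟩
      · rintro ⟨x, hx⟩
        have : f x = p := congrArg Subtype.val hx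
        refine Subtype.ext ?_
        change g p = 0
        rw [← this, hgf]
    · ext ⟨q, hq⟩
      constructor
      · intro hx
        have : q ∈ LinearMap.ker h := hx
        rw [hgh] at this
        obtain ⟨p, rfl⟩ := this
        exact ⟨⟨p, hq⟩, rfl⟩
      · rintro ⟨p, hx⟩
        have : g p = q := congrArg Subtype.val hx
        change h q = 0
        rw [← this, hhg]

/-- let `A` be a finite dimensional selfinjective algebra all of whose
projective indecomposables have the same dimension `d`, and `X` a module of length `3`
with simple socle and head of length `2`.  If `Ω²(X) ≅ X`, i.e. there is an exact
sequence `0 → X → P → Q → X → 0` with `P, Q` projective and `dim P = dim Q`, then a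
contradiction arises. -/
theorem no_period_two_length_three
    (k : Type) [Field k] [IsAlgClosed k]
    (A : Type) [Ring A] [Algebra k A] [FiniteDimensional k A]
    (hself : Module.Injective A A)
    (d : ℕ)
    -- all projective indecomposable modules have the same `k`-dimension `d`
    (hsame : ∀ R : ModuleCat.{0} A, Module.Finite A R → Module.Projective A R →
      IsIndecomposableModule A R → Module.finrank k (RestrictScalars k A R) = d)
    (X P Q : Type)
    [AddCommGroup X] [Module A X] [Module k X] [IsScalarTower k A X] [Module.Finite A X]
    [AddCommGroup P] [Module A P] [Module k P] [IsScalarTower k A P] [Module.Finite A P]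
    [AddCommGroup Q] [Module A Q] [Module k Q] [IsScalarTower k A Q] [Module.Finite A Q]
    (hlen : moduleLengthIs A X 3)
    (hsoc : IsSimpleModule A (moduleSocle A X))
    (hhead : moduleLengthIs A (X ⧸ moduleRadical A X) 2)
    (hP : Module.Projective A P) (hQ : Module.Projective A Q)
    (f : X →ₗ[A] P) (g : P →ₗ[A] Q) (h : Q →ₗ[A] X)
    (hf : Function.Injective f) (hh : Function.Surjective h)
    (hfg : LinearMap.ker g = LinearMap.range f)
    (hgh : LinearMap.ker h = LinearMap.range g)
    (hdim : Module.finrank k P = Module.finrank k Q) :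
    False := by
  exact aux_main k A hself d hsame X hsoc hhead _ P Q hP hQ f g h hf hh hfg hgh hdim rfl
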